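/- Let S be an inverse semigroup and let U = ⟨e, x⟩, where x ∈ N_S is a nongroup element and e ∈ E_S is an idempotent such that e·x ∈ N_S and e is x-covered by x·x⁻¹. Then the 𝓗-class of e in U is trivial: every u ∈ U with u·u⁻¹ = e and u⁻¹·u = e equals e. -/

import Mathlib

/-- An inverse semigroup: a semigroup in which every element `a` has a unique
element `a⁻¹` with `a * a⁻¹ * a = a` and `a⁻¹ * a * a⁻¹ = a⁻¹`. -/
class InverseSemigroup (S : Type*) extends Semigroup S, Inv S where
  mul_inv_mul : ∀ a : S, a * a⁻¹ * a = a
  inv_mul_inv : ∀ a : S, a⁻¹ * a * a⁻¹ = a⁻¹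
  inv_unique : ∀ a b : S, a * b * a = a → b * a * b = b → b = a⁻¹

section InvSgDefs

variable (S : Type*) [InverseSemigroup S]

/-- The set of idempotents of `S`. -/
def ES : Set S := {e : S | IsIdempotentElem e}

/-- The set of nongroup elements of `S`. -/
def NS : Set S := {x : S | x * x⁻¹ ≠ x⁻¹ * x}

/-- `N_S ∪ E_S`. -/
def NE : Set S := NS S ∪ ES S

variable {S}

/-- The order on idempotents: `e ≤ f` iff `e * f = e`. -/
def idemLe (e f : S) : Prop := e * f = e

/-- Strict order on idempotents. -/
def idemLt (e f : S) : Prop := idemLe e f ∧ e ≠ f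

/-- The natural partial order on an inverse semigroup: `a ≤ b` iff `a = e * b`
for some idempotent `e`. -/
def natLe (a b : S) : Prop := ∃ e : S, IsIdempotentElem e ∧ a = e * b

/-- Green's relation `𝓡`. -/
def rRel (a b : S) : Prop := a * a⁻¹ = b * b⁻¹

/-- Green's relation `𝓛`. -/
def lRel (a b : S) : Prop := a⁻¹ * a = b⁻¹ * b

/-- Green's relation `𝓗`. -/
def hRel (a b : S) : Prop := rRel a b ∧ lRel a b

/-- Green's relation `𝓓`. -/
def dRel (a b : S) : Prop := ∃ c : S, rRel a c ∧ lRel c b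

/-- `U` is an inverse subsemigroup of `S`: closed under multiplication and inversion. -/
def IsInvSub (U : Set S) : Prop :=
  (∀ a ∈ U, ∀ b ∈ U, a * b ∈ U) ∧ ∀ a ∈ U, a⁻¹ ∈ U

/-- The inverse subsemigroup generated by `X`: the smallest subset of `S`
containing `X` and closed under multiplication and inversion. -/
def genInv (X : Set S) : Set S := ⋂₀ {U : Set S | IsInvSub U ∧ X ⊆ U}

/-- `e` is `x`-covered by `x * x⁻¹`: `e < x * x⁻¹` and no idempotent `f` of `⟨x⟩`
satisfies `e < f < x * x⁻¹`. -/
def XCov (x e : S) : Prop :=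
  idemLt e (x * x⁻¹) ∧
    ∀ f ∈ genInv ({x} : Set S), IsIdempotentElem f →
      ¬(idemLt e f ∧ idemLt f (x * x⁻¹))

/-- `e` is tightly `x`-covered by `x * x⁻¹`. -/
def TightXCov (x e : S) : Prop :=
  XCov x e ∧ (e * x ∈ NS S ∨ IsIdempotentElem (e * x))

/-- A short bypass from `e` to `x * x⁻¹`. -/
def ShortBypass (x e : S) : Prop :=
  ∃ n : ℕ, 1 ≤ n ∧ ∃ es : ℕ → S,
    es 0 = e ∧ es n = x * x⁻¹ ∧ (∀ k ≤ n, IsIdempotentElem (es k)) ∧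
    ∀ k : ℕ, 1 ≤ k → k ≤ n → idemLt (es (k - 1)) (es k) ∧ XCov (es k * x) (es (k - 1))

/-- A tight bypass from `e` to `x * x⁻¹`. -/
def TightBypass (x e : S) : Prop :=
  ∃ n : ℕ, 1 ≤ n ∧ ∃ es : ℕ → S,
    es 0 = e ∧ es n = x * x⁻¹ ∧ (∀ k ≤ n, IsIdempotentElem (es k)) ∧
    ∀ k : ℕ, 1 ≤ k → k ≤ n → idemLt (es (k - 1)) (es k) ∧ TightXCov (es k * x) (es (k - 1))

variable (S)

/-- `S` is shortly connected. -/
def ShortlyConnected : Prop :=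
  ∀ x : S, ∀ e : S, IsIdempotentElem e → idemLt e (x * x⁻¹) → ShortBypass x e

/-- `S` is tightly connected. -/
def TightlyConnected : Prop :=
  ∀ x ∈ NE S, ∀ e : S, IsIdempotentElem e → idemLt e (x * x⁻¹) → TightBypass x e

/-- `S` is fundamental. -/
def Fundamental : Prop :=
  ∀ x y : S, (∀ e : S, IsIdempotentElem e → x⁻¹ * e * x = y⁻¹ * e * y) → x = y

/-- `S` is combinatorial. -/
def Combinatorial : Prop :=
  ∀ a b : S, a * a⁻¹ = b * b⁻¹ → a⁻¹ * a = b⁻¹ * b → a = b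

/-- `S` has no isolated nontrivial subgroups: for every idempotent `e` whose
`𝓗`-class is nontrivial there is an idempotent `f ≠ e` with `e 𝓓 f`. -/
def NoIsolatedNontrivial : Prop :=
  ∀ e : S, IsIdempotentElem e → (∃ h : S, h ≠ e ∧ hRel h e) →
    ∃ f : S, IsIdempotentElem f ∧ f ≠ e ∧ dRel e f

/-- `S` is completely semisimple. -/
def CompletelySemisimple : Prop :=
  ∀ e f : S, IsIdempotentElem e → IsIdempotentElem f → idemLe e f → dRel e f → e = f

end InvSgDefs

namespace InvAux

variable {S : Type*} [InverseSemigroup S]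

open InverseSemigroup

theorem mim (a : S) : a * (a⁻¹ * a) = a := by rw [← mul_assoc]; exact mul_inv_mul a
theorem imi (a : S) : a⁻¹ * (a * a⁻¹) = a⁻¹ := by rw [← mul_assoc]; exact inv_mul_inv a

theorem mim' (a b : S) : a * (a⁻¹ * (a * b)) = a * b := by
  rw [← mul_assoc a⁻¹, ← mul_assoc, mim]
theorem imi' (a b : S) : a⁻¹ * (a * (a⁻¹ * b)) = a⁻¹ * b := by
  rw [← mul_assoc a, ← mul_assoc, imi]

theorem inv_inv' (a : S) : a⁻¹⁻¹ = a :=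
  (inv_unique a⁻¹ a (inv_mul_inv a) (mul_inv_mul a)).symm

theorem idem_inv {e : S} (he : IsIdempotentElem e) : e⁻¹ = e :=
  (inv_unique e e (by rw [he.eq, he.eq]) (by rw [he.eq, he.eq])).symm

theorem idem_mul_aux {e f : S} (he : IsIdempotentElem e) (hf : IsIdempotentElem f) :
    IsIdempotentElem (e * f) := by
  have he' : ∀ b, e * (e * b) = e * b := fun b => by rw [← mul_assoc, he.eq]
  have hf' : ∀ b, f * (f * b) = f * b := fun b => by rw [← mul_assoc, hf.eq]
  obtain ⟨z, hz⟩ : ∃ z, z = (e * f)⁻¹ := ⟨_, rfl⟩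
  have h1 : e * (f * (z * (e * f))) = e * f := by
    have := mul_inv_mul (e * f); rw [← hz] at this; simpa only [mul_assoc] using this
  have h2 : z * (e * (f * z)) = z := by
    have := inv_mul_inv (e * f); rw [← hz] at this; simpa only [mul_assoc] using this
  have h2' : ∀ b, z * (e * (f * (z * b))) = z * b := fun b => by
    conv_rhs => rw [← h2]
    simp only [mul_assoc]
  have h3 : f * (z * e) = z := by
    rw [hz]; apply InverseSemigroup.inv_unique
    · rw [← hz]; simp only [mul_assoc, he', hf', h1]
    · rw [← hz]; simp only [mul_assoc, he', hf', h2']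
  have h4 : IsIdempotentElem z := by
    change z * z = z
    calc z * z = f * (z * e) * (f * (z * e)) := by rw [h3]
      _ = f * (z * e) := by simp only [mul_assoc, h2']
      _ = z := h3
  have h5 : e * f = z := by
    have := inv_inv' (e * f)
    rw [← hz, idem_inv h4] at this
    exact this.symm
  rw [h5]; exact h4

theorem idem_comm {e f : S} (he : IsIdempotentElem e) (hf : IsIdempotentElem f) :
    e * f = f * e := by
  have he' : ∀ b, e * (e * b) = e * b := fun b => by rw [← mul_assoc, he.eq]
  have hf' : ∀ b, f * (f * b) = f * b := fun b => by rw [← mul_assoc, hf.eq]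
  have h1 : e * (f * (e * f)) = e * f := by
    have := (idem_mul_aux he hf).eq; simpa only [mul_assoc] using this
  have h2 : f * (e * (f * e)) = f * e := by
    have := (idem_mul_aux hf he).eq; simpa only [mul_assoc] using this
  have h3 : f * e = (e * f)⁻¹ := by
    apply InverseSemigroup.inv_unique
    · simp only [mul_assoc, he', hf', h1]
    · simp only [mul_assoc, he', hf', h2]
  rw [h3, idem_inv (idem_mul_aux he hf)]

theorem idem_mi (a : S) : IsIdempotentElem (a * a⁻¹) := by
  change a * a⁻¹ * (a * a⁻¹) = a * a⁻¹
  rw [← mul_assoc, mul_inv_mul]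

theorem idem_im (a : S) : IsIdempotentElem (a⁻¹ * a) := by
  change a⁻¹ * a * (a⁻¹ * a) = a⁻¹ * a
  rw [← mul_assoc, inv_mul_inv]

theorem mul_inv' (a b : S) : (a * b)⁻¹ = b⁻¹ * a⁻¹ := by
  have h : b * b⁻¹ * (a⁻¹ * a) = a⁻¹ * a * (b * b⁻¹) := idem_comm (idem_mi b) (idem_im a)
  symm
  apply InverseSemigroup.inv_unique
  · calc a * b * (b⁻¹ * a⁻¹) * (a * b) = a * (b * b⁻¹ * (a⁻¹ * a)) * b := by
          simp only [mul_assoc]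
      _ = a * b := by rw [h]; simp only [mul_assoc, mim', mim]
  · calc b⁻¹ * a⁻¹ * (a * b) * (b⁻¹ * a⁻¹) = b⁻¹ * (a⁻¹ * a * (b * b⁻¹)) * a⁻¹ := by
          simp only [mul_assoc]
      _ = b⁻¹ * a⁻¹ := by rw [← h]; simp only [mul_assoc, imi', imi]

/-- idempotents move past elements -/
theorem mul_idem (a : S) {f : S} (hf : IsIdempotentElem f) : a * f = a * f * a⁻¹ * a := by
  have h := idem_comm hf (idem_im a)
  calc a * f = a * (a⁻¹ * a * f) := by simp only [mul_assoc, mim']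
    _ = a * f * a⁻¹ * a := by rw [← h]; simp only [mul_assoc]

theorem idem_conj (a : S) {f : S} (hf : IsIdempotentElem f) :
    IsIdempotentElem (a * f * a⁻¹) := by
  change a * f * a⁻¹ * (a * f * a⁻¹) = a * f * a⁻¹
  calc a * f * a⁻¹ * (a * f * a⁻¹) = (a * f * a⁻¹ * a) * (f * a⁻¹) := by simp only [mul_assoc]
    _ = a * (f * f) * a⁻¹ := by rw [← mul_idem a hf]; simp only [mul_assoc]
    _ = _ := by rw [hf.eq]

theorem idem_conj' (a : S) {f : S} (hf : IsIdempotentElem f) :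
    IsIdempotentElem (a⁻¹ * f * a) := by
  have := idem_conj a⁻¹ hf
  rwa [inv_inv'] at this

/-- conjugation is multiplicative on idempotents -/
theorem conj_mul (a : S) {f g : S} (hf : IsIdempotentElem f) :
    (a⁻¹ * f * a) * (a⁻¹ * g * a) = a⁻¹ * (f * g) * a := by
  have h := mul_idem a⁻¹ hf
  rw [inv_inv'] at h
  calc (a⁻¹ * f * a) * (a⁻¹ * g * a) = (a⁻¹ * f * a * a⁻¹) * (g * a) := by
        simp only [mul_assoc]
    _ = _ := by rw [← h]; simp only [mul_assoc]

/-- `pw x n = x ^ (n+1)` -/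
def pw (x : S) : ℕ → S
  | 0 => x
  | n + 1 => x * pw x n

theorem pw_succ' (x : S) (n : ℕ) : pw x (n + 1) = pw x n * x := by
  induction n with
  | zero => rfl
  | succ n ih =>
    change x * pw x (n + 1) = x * pw x n * x
    rw [ih, mul_assoc]

def PP (x u : S) : Prop :=
  IsIdempotentElem u ∨ (∃ n, natLe u (pw x n)) ∨ (∃ n, natLe u⁻¹ (pw x n))

theorem natLe_mul_right {a b f : S} (hf : IsIdempotentElem f) (h : natLe a b) :
    natLe (a * f) b := by
  obtain ⟨g, hg, rfl⟩ := h
  refine ⟨g * (b * f * b⁻¹), idem_mul_aux hg (idem_conj b hf), ?_⟩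
  calc g * b * f = g * (b * f) := mul_assoc _ _ _
    _ = g * (b * f * b⁻¹ * b) := congrArg (g * ·) (mul_idem b hf)
    _ = _ := by simp only [mul_assoc]

theorem natLe_mul_left {a b f : S} (hf : IsIdempotentElem f) (h : natLe a b) :
    natLe (f * a) b := by
  obtain ⟨g, hg, rfl⟩ := h
  exact ⟨f * g, idem_mul_aux hf hg, by rw [mul_assoc]⟩

theorem PP_e {x v e : S} (he : IsIdempotentElem e) (h : PP x v) : PP x (v * e) := by
  rcases h with h | ⟨n, h⟩ | ⟨n, h⟩
  · exact Or.inl (idem_mul_aux h he)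
  · exact Or.inr (Or.inl ⟨n, natLe_mul_right he h⟩)
  · refine Or.inr (Or.inr ⟨n, ?_⟩)
    rw [mul_inv', idem_inv he]
    exact natLe_mul_left he h

theorem PP_x {x v : S} (h : PP x v) : PP x (v * x) := by
  rcases h with h | ⟨n, f, hf, h⟩ | ⟨n, f, hf, h⟩
  · exact Or.inr (Or.inl ⟨0, v, h, rfl⟩)
  · refine Or.inr (Or.inl ⟨n + 1, f, hf, ?_⟩)
    rw [pw_succ', h, mul_assoc]
  · have hv : v = (pw x n)⁻¹ * f := by
      rw [← inv_inv' v, h, mul_inv', idem_inv hf]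
    cases n with
    | zero =>
      left
      rw [hv]
      exact idem_conj' x hf
    | succ n =>
      refine Or.inr (Or.inr ⟨n, x⁻¹ * f * x, idem_conj' x hf, ?_⟩)
      rw [mul_inv', h]
      simp only [pw, mul_assoc]

theorem PP_xi {x v : S} (h : PP x v) : PP x (v * x⁻¹) := by
  rcases h with h | ⟨n, f, hf, h⟩ | ⟨n, f, hf, h⟩
  · refine Or.inr (Or.inr ⟨0, x * v * x⁻¹, idem_conj x h, ?_⟩)
    rw [mul_inv', inv_inv', idem_inv h]
    exact mul_idem x h
  · cases n with
    | zero =>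
      left
      rw [h, mul_assoc]
      exact idem_mul_aux hf (idem_mi x)
    | succ n =>
      refine Or.inr (Or.inl ⟨n, ?_⟩)
      rw [h, pw_succ']
      have : f * (pw x n * x) * x⁻¹ = f * pw x n * (x * x⁻¹) := by simp only [mul_assoc]
      rw [this]
      exact natLe_mul_right (idem_mi x) ⟨f, hf, rfl⟩
  · refine Or.inr (Or.inr ⟨n + 1, x * f * x⁻¹, idem_conj x hf, ?_⟩)
    rw [mul_inv', inv_inv', h, ← mul_assoc]
    calc x * f * pw x n = x * f * x⁻¹ * x * pw x n := congrArg (· * pw x n) (mul_idem x hf)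
      _ = _ := by simp only [pw, mul_assoc]

theorem PP_gen {x e : S} (he : IsIdempotentElem e) {u : S}
    (hu : u ∈ genInv ({e, x} : Set S)) : ∀ v, PP x v → PP x (v * u) := by
  have key : u ∈ {u : S | (∀ v, PP x v → PP x (v * u)) ∧ (∀ v, PP x v → PP x (v * u⁻¹))} := by
    refine hu _ ⟨⟨?_, ?_⟩, ?_⟩
    · rintro a ⟨ha, ha'⟩ b ⟨hb, hb'⟩
      refine ⟨fun v hv => ?_, fun v hv => ?_⟩
      · rw [← mul_assoc]; exact hb _ (ha _ hv)
      · rw [mul_inv', ← mul_assoc]; exact ha' _ (hb' _ hv)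
    · rintro a ⟨ha, ha'⟩
      refine ⟨ha', ?_⟩
      rw [inv_inv']; exact ha
    · rintro a (rfl | rfl)
      · refine ⟨fun v hv => PP_e he hv, ?_⟩
        rw [idem_inv he]
        exact fun v hv => PP_e he hv
      · exact ⟨fun v hv => PP_x hv, fun v hv => PP_xi hv⟩
  exact key.1

theorem le_left {e a b : S} (h : e * ((a * b) * (a * b)⁻¹) = e) : e * (a * a⁻¹) = e := by
  rw [← h, mul_inv']
  have : a * b * (b⁻¹ * a⁻¹) * (a * a⁻¹) = a * b * (b⁻¹ * a⁻¹) := by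
    simp only [mul_assoc, imi]
  rw [mul_assoc, this]

theorem le_right {e a b : S} (h : e * ((a * b)⁻¹ * (a * b)) = e) : e * (b⁻¹ * b) = e := by
  rw [← h, mul_inv']
  have : b⁻¹ * a⁻¹ * (a * b) * (b⁻¹ * b) = b⁻¹ * a⁻¹ * (a * b) := by
    simp only [mul_assoc, mim]
  rw [mul_assoc, this]

theorem core {x e : S} (hx : x ∈ NS S) (he : IsIdempotentElem e) (hex : e * x ∈ NS S)
    (hcov : XCov x e) (n : ℕ) (h1 : e * (pw x n * (pw x n)⁻¹) = e)
    (h2 : (pw x n)⁻¹ * e * pw x n = e) : False := by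
  have hxx : e * (x * x⁻¹) = e := hcov.1.1
  -- it suffices that conjugation by x fixes e
  have fin : x⁻¹ * e * x ≠ e := by
    intro h
    apply hex
    rw [mul_inv', idem_inv he]
    have a1 : e * x * (x⁻¹ * e) = e := by
      calc e * x * (x⁻¹ * e) = e * (x * x⁻¹) * e := by simp only [mul_assoc]
        _ = e := by rw [hxx, he.eq]
    have a2 : x⁻¹ * e * (e * x) = e := by
      calc x⁻¹ * e * (e * x) = x⁻¹ * (e * e) * x := by simp only [mul_assoc]
        _ = e := by rw [he.eq, h]
    rw [a1, a2]
  have h3 : e * ((pw x n)⁻¹ * pw x n) = e := by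
    conv_lhs => rw [← h2]
    simp only [mul_assoc, mim]
    simpa only [mul_assoc] using h2
  have b1 : e * ((x * x) * (x * x)⁻¹) = e ∧ e * ((x * x)⁻¹ * (x * x)) = e := by
    rcases n with _ | _ | n
    · exact absurd h2 fin
    · exact ⟨h1, h3⟩
    · constructor
      · apply le_left (b := pw x n)
        have : pw x (n + 1 + 1) = x * x * pw x n := by simp only [pw, mul_assoc]
        rwa [this] at h1
      · apply le_right (a := pw x n)
        have : pw x (n + 1 + 1) = pw x n * (x * x) := by rw [pw_succ', pw_succ', mul_assoc]
        rwa [this] at h3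
  obtain ⟨b1, b2⟩ := b1
  have b3 : e * (x⁻¹ * x) = e := le_right b2
  have hA := idem_mi (x * x)
  have hB := idem_im x
  obtain ⟨f, hfdef⟩ : ∃ f, f = (x * x) * (x * x)⁻¹ * (x⁻¹ * x) := ⟨_, rfl⟩
  have hf : IsIdempotentElem f := by rw [hfdef]; exact idem_mul_aux hA hB
  have ef : e * f = e := by rw [hfdef, ← mul_assoc, b1, b3]
  have hfg : f ∈ genInv ({x} : Set S) := by
    rintro V ⟨⟨hm, hi⟩, hV⟩
    have hxV : x ∈ V := hV rfl
    rw [hfdef]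
    exact hm _ (hm _ (hm _ hxV _ hxV) _ (hi _ (hm _ hxV _ hxV))) _ (hm _ (hi _ hxV) _ hxV)
  have fx : f * (x * x⁻¹) = f := by
    have hc := idem_comm hB (idem_mi x)
    rw [hfdef, mul_assoc, hc, ← mul_assoc]
    congr 1
    rw [mul_inv']
    simp only [mul_assoc, imi]
  have hor := hcov.2 f hfg hf
  by_cases hfe : e = f
  swap
  · -- then f = x x⁻¹
    have hfx : f = x * x⁻¹ := by
      by_contra hne
      exact hor ⟨⟨ef, hfe⟩, ⟨fx, hne⟩⟩
    have c1 : (x * x⁻¹) * (x⁻¹ * x) = x * x⁻¹ := by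
      rw [← hfx, hfdef, mul_assoc, hB.eq]
    have c2 : (x * x⁻¹) * ((x * x) * (x * x)⁻¹) = x * x⁻¹ := by
      rw [← hfx, idem_comm hf hA, hfdef, ← mul_assoc, hA.eq]
    have c3 : (x * x) * (x * x)⁻¹ = x * x⁻¹ := by
      rw [← c2, mul_inv']
      simp only [mul_assoc, mim']
    have c4 : (x⁻¹ * x) * (x * x⁻¹) * (x⁻¹ * x) = x⁻¹ * x := by
      calc (x⁻¹ * x) * (x * x⁻¹) * (x⁻¹ * x) = x⁻¹ * ((x * x) * (x * x)⁻¹) * x := by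
            rw [mul_inv']; simp only [mul_assoc]
        _ = x⁻¹ * x := by rw [c3]; simp only [mul_assoc, imi']
    apply hx
    rw [← c4, mul_assoc, c1, idem_comm hB (idem_mi x), c1]
  · -- e = f, so e ≤ x⁻¹ e x
    have d1 : e * (x⁻¹ * e * x) = e := by
      have : x⁻¹ * e * x =
          ((x⁻¹ * x) * (x * x⁻¹) * (x⁻¹ * x)) * ((x * x)⁻¹ * (x * x)) := by
        conv_lhs => rw [hfe, hfdef, ← conj_mul x hA]
        simp only [mul_inv', mul_assoc]
      rw [this, ← mul_assoc e, ← mul_assoc e (x⁻¹ * x * (x * x⁻¹)),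
        ← mul_assoc e (x⁻¹ * x) (x * x⁻¹), b3, hxx, b3, b2]
    have hce := idem_conj' x he
    have mono : ∀ k, (x⁻¹ * e * x) * ((pw x k)⁻¹ * e * pw x k) = x⁻¹ * e * x := by
      intro k
      induction k with
      | zero => exact hce.eq
      | succ k ih =>
        have h5 : e * ((pw x k)⁻¹ * e * pw x k) = e := by
          calc e * ((pw x k)⁻¹ * e * pw x k)
              = e * (x⁻¹ * e * x) * ((pw x k)⁻¹ * e * pw x k) := by rw [d1]
            _ = e := by rw [mul_assoc, ih, d1]
        have : (pw x (k + 1))⁻¹ * e * pw x (k + 1) =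
            x⁻¹ * ((pw x k)⁻¹ * e * pw x k) * x := by
          rw [pw_succ', mul_inv']; simp only [mul_assoc]
        rw [this, conj_mul x he, h5]
    have h6 := mono n
    rw [h2] at h6
    apply fin
    rw [← h6, idem_comm hce he, d1]

theorem half {x e : S} (hx : x ∈ NS S) (he : IsIdempotentElem e) (hex : e * x ∈ NS S)
    (hcov : XCov x e) {u : S} {n : ℕ} (h : natLe u (pw x n)) (h1 : u * u⁻¹ = e)
    (h2 : u⁻¹ * u = e) : False := by
  obtain ⟨f, hf, h⟩ := h
  have fu : f * u = u := by rw [h, ← mul_assoc, hf.eq]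
  have fe : f * e = e := by rw [← h1, ← mul_assoc, fu]
  have eu : e * u = u := by rw [← h1, mul_inv_mul]
  have hu : u = e * pw x n := by
    calc u = e * u := eu.symm
      _ = e * f * pw x n := by rw [h, mul_assoc]
      _ = e * pw x n := by rw [idem_comm he hf, fe]
  have hui : u⁻¹ = (pw x n)⁻¹ * e := by rw [hu, mul_inv', idem_inv he]
  refine core hx he hex hcov n ?_ ?_
  · have : e = e * (pw x n * (pw x n)⁻¹) * e := by
      conv_lhs => rw [← h1, hui, hu]
      simp only [mul_assoc]
    rw [mul_assoc, idem_comm (idem_mi _) he, ← mul_assoc, he.eq] at this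
    exact this.symm
  · calc (pw x n)⁻¹ * e * pw x n = (pw x n)⁻¹ * (e * e) * pw x n := by rw [he.eq]
      _ = (pw x n)⁻¹ * e * (e * pw x n) := by simp only [mul_assoc]
      _ = e := by rw [← hui, ← hu, h2]

end InvAux

/-- if `x` is a nongroup element and `e` an idempotent with
`e * x` nongroup and `e` `x`-covered by `x * x⁻¹`, then the `𝓗`-class of `e` in
`U = ⟨e, x⟩` is trivial. -/
theorem stmt2 {S : Type*} [InverseSemigroup S] (x e : S) (hx : x ∈ NS S)
    (he : IsIdempotentElem e) (hex : e * x ∈ NS S) (hcov : XCov x e) :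
    ∀ u ∈ genInv ({e, x} : Set S), u * u⁻¹ = e → u⁻¹ * u = e → u = e := by
  intro u hu h1 h2
  have h := InvAux.PP_gen he hu e (Or.inl he)
  have eu : e * u = u := by rw [← h1, InverseSemigroup.mul_inv_mul]
  rw [eu] at h
  rcases h with h | ⟨n, h⟩ | ⟨n, h⟩
  · rw [InvAux.idem_inv h, h.eq] at h1
    exact h1
  · exact (InvAux.half hx he hex hcov h h1 h2).elim
  · refine (InvAux.half hx he hex hcov h ?_ ?_).elim
    · rw [InvAux.inv_inv', h2]
    · rw [InvAux.inv_inv', h1]
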